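/- arXiv:1907.08579 — 7 statements merged into one kernel-verified Lean document; each statement's English description precedes it below -/
import Mathlib

section
/- Let c be a list of length n, let s, r be indices with 1 ≤ s ≤ r ≤ n, and let T be a real number with T ≥ 1. Suppose F(c[s..r]) ≥ T and either r = s or F(c[s..r−1]) < T (i.e., r is the smallest index at which the mode frequency of the prefix range starting at s reaches T). Then count(c[r], c[s..r]) ≥ T, and for every element x ≠ c[r] one has count(x, c[s..r]) < T; in particular c[r] is the unique mode of c[s..r]. -/
/-- The frequency of a mode of a list: the maximum number of occurrences of any element. -/
def modeFreq {α : Type*} [DecidableEq α] (c : List α) : ℕ :=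
  (c.map (fun x => c.count x)).foldr max 0

/-- The contiguous sublist `c[a..b]` of `c` with 1-based inclusive indices. -/
def rangeSlice {α : Type*} (c : List α) (a b : ℕ) : List α :=
  (c.drop (a - 1)).take (b + 1 - a)

theorem count_le_modeFreq {α : Type*} [DecidableEq α] (c : List α) (x : α) :
    c.count x ≤ modeFreq c := by
  by_cases hx : x ∈ c
  · exact List.le_max_of_le (List.mem_map_of_mem hx) le_rfl
  · simp [List.count_eq_zero_of_not_mem hx]

theorem List.foldr_max_zero_eq_zero_or_mem (l : List ℕ) :
    l.foldr max 0 = 0 ∨ l.foldr max 0 ∈ l := by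
  induction l with
  | nil => simp
  | cons a l ih =>
    rw [List.foldr_cons, List.mem_cons]
    rcases max_choice a (l.foldr max 0) with h | h <;> rw [h] <;> tauto

theorem exists_count_eq_modeFreq {α : Type*} [DecidableEq α] {c : List α}
    (h : modeFreq c ≠ 0) : ∃ x, c.count x = modeFreq c := by
  obtain h0 | hmem := (c.map (fun x => c.count x)).foldr_max_zero_eq_zero_or_mem
  · exact absurd h0 h
  · obtain ⟨x, -, hx⟩ := List.mem_map.mp hmem
    exact ⟨x, hx⟩

theorem rangeSlice_eq_append_getD {α : Type*} (c : List α) {s r : ℕ} (d : α)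
    (hs : 1 ≤ s) (hsr : s ≤ r) (hrn : r ≤ c.length) :
    rangeSlice c s r = rangeSlice c s (r - 1) ++ [c.getD (r - 1) d] := by
  have hlen : r - s < (c.drop (s - 1)).length := by rw [List.length_drop]; omega
  have hidx : s - 1 + (r - s) = r - 1 := by omega
  rw [rangeSlice, rangeSlice, show r + 1 - s = r - s + 1 by omega,
    show r - 1 + 1 - s = r - s by omega, List.take_add_one, List.getElem?_eq_getElem hlen,
    List.getElem_drop, List.getD_eq_getElem c d (by omega)]
  simp only [hidx, Option.toList_some]

/-- If `r` is the smallest index at which the mode frequency of the range starting at `s`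
reaches a threshold `T ≥ 1`, then `c[r]` occurs at least `T` times in `c[s..r]` and every
other element occurs fewer than `T` times, i.e. `c[r]` is the unique mode of `c[s..r]`. -/
theorem stmt0 {α : Type*} [DecidableEq α] [Inhabited α] (c : List α) (s r : ℕ) (T : ℝ)
    (hs : 1 ≤ s) (hsr : s ≤ r) (hrn : r ≤ c.length) (hT : 1 ≤ T)
    (hF : (modeFreq (rangeSlice c s r) : ℝ) ≥ T)
    (hmin : r = s ∨ (modeFreq (rangeSlice c s (r - 1)) : ℝ) < T) :
    ((rangeSlice c s r).count (c.getD (r - 1) default) : ℝ) ≥ T ∧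
      ∀ x : α, x ≠ c.getD (r - 1) default → ((rangeSlice c s r).count x : ℝ) < T := by
  have hprev : (modeFreq (rangeSlice c s (r - 1)) : ℝ) < T := by
    rcases hmin with rfl | h
    · have hnil : rangeSlice c r (r - 1) = [] := by
        rw [rangeSlice, show r - 1 + 1 - r = 0 by omega, List.take_zero]
      rw [hnil]
      simpa [modeFreq] using zero_lt_one.trans_le hT
    · exact h
  have hother : ∀ x : α, x ≠ c.getD (r - 1) default → ((rangeSlice c s r).count x : ℝ) < T := by
    intro x hx
    rw [rangeSlice_eq_append_getD c default hs hsr hrn, List.count_append,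
      List.count_singleton, if_neg (by simpa using hx.symm), add_zero]
    exact lt_of_le_of_lt (by exact_mod_cast count_le_modeFreq _ x) hprev
  refine ⟨?_, hother⟩
  have hne : modeFreq (rangeSlice c s r) ≠ 0 := by
    intro h
    rw [h, Nat.cast_zero] at hF
    linarith
  obtain ⟨x, hx⟩ := exists_count_eq_modeFreq hne
  rw [← hx] at hF
  by_cases hxr : x = c.getD (r - 1) default
  · rwa [← hxr]
  · exact absurd hF (not_le.mpr (hother x hxr))
end

section
/- Let ε ∈ (0,1] and Δ > 0 satisfy (1+Δ)² = 1+ε, let k ≥ 1 be an integer, let c be a list of length n, and let 1 ≤ a ≤ b ≤ n. Suppose s ≤ a with a − s < (Δ/ε)·(1+Δ)^{2k−1} and s' ≤ a with a − s' < (Δ/ε)·(1+Δ)^{2k}. Let r be the least index with r ≥ s and F(c[s..r]) ≥ (1+Δ)^{2k}/ε, and let r' be the least index with r' ≥ s' and F(c[s'..r']) ≥ (1+Δ)^{2k+1}/ε; assume r ≤ n and r' ≤ n. Then: (1) if b < r, then F(c[a..b]) < (1+Δ)^{2k}/ε; (2) if b ≥ r', then count(c[r'], c[a..b]) > (1+Δ)^{2k}/ε;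 (3) if r ≤ b < r', then count(c[r], c[a..b]) > (1+Δ)^{2k−1}/ε and F(c[a..b]) < (1+Δ)^{2k+1}/ε. (Here (1+Δ)^{2k} = (1+ε)^k, so these thresholds equal (1+ε)^k/ε, (1+ε)^{k−1/2}/ε, and (1+ε)^{k+1/2}/ε respectively.) -/
section RangeSlice

variable {α : Type*}

theorem rangeSlice_eq_drop_take (c : List α) {a : ℕ} (ha : 1 ≤ a) (b : ℕ) :
    rangeSlice c a b = (c.take b).drop (a - 1) := by
  rw [rangeSlice, List.drop_take]
  congr 1
  omega

theorem rangeSlice_eq_drop_rangeSlice (c : List α) {s a : ℕ} (hs : 1 ≤ s) (hsa : s ≤ a) (b : ℕ) :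
    rangeSlice c a b = (rangeSlice c s b).drop (a - s) := by
  rw [rangeSlice_eq_drop_take c hs, rangeSlice_eq_drop_take c (hs.trans hsa), List.drop_drop]
  congr 1
  omega

theorem rangeSlice_succ (c : List α) {s t : ℕ} (hs : 1 ≤ s) (hst : s ≤ t + 1)
    (ht : t < c.length) (d : α) :
    rangeSlice c s (t + 1) = rangeSlice c s t ++ [c.getD t d] := by
  rw [rangeSlice_eq_drop_take c hs, rangeSlice_eq_drop_take c hs, List.take_succ_eq_append_getElem ht,
    List.drop_append_of_le_length (by simp; omega), List.getD_eq_getElem c d ht]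

theorem rangeSlice_prefix (c : List α) {s r b : ℕ} (h : r ≤ b) :
    rangeSlice c s r <+: rangeSlice c s b :=
  List.take_prefix_take_left (by omega)

end RangeSlice

section ModeFreq

variable {α : Type*} [DecidableEq α]

theorem modeFreq_le_iff (l : List α) (m : ℕ) : modeFreq l ≤ m ↔ ∀ x, l.count x ≤ m := by
  have key : ∀ l' : List ℕ, l'.foldr max 0 ≤ m ↔ ∀ y ∈ l', y ≤ m := fun l' => by
    induction l' with
    | nil => simp
    | cons y t ih => simp [ih]
  rw [modeFreq, key, List.forall_mem_map]
  refine ⟨fun h x => ?_, fun h x _ => h x⟩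
  by_cases hx : x ∈ l
  · exact h x hx
  · simp [List.count_eq_zero_of_not_mem hx]

theorem count_le_modeFreq_s1 (l : List α) (x : α) : l.count x ≤ modeFreq l :=
  (modeFreq_le_iff l _).1 le_rfl x

theorem List.Sublist.modeFreq_le {l₁ l₂ : List α} (h : l₁.Sublist l₂) :
    modeFreq l₁ ≤ modeFreq l₂ :=
  (modeFreq_le_iff _ _).2 fun x => (h.count_le x).trans (count_le_modeFreq_s1 l₂ x)

theorem modeFreq_concat_le (l : List α) (x : α) :
    modeFreq (l ++ [x]) ≤ max ((l ++ [x]).count x) (modeFreq l) := by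
  rw [modeFreq_le_iff]
  intro y
  by_cases hy : y = x
  · simp [hy]
  · refine le_max_of_le_right ?_
    simpa [List.count_append, List.count_singleton, Ne.symm hy] using count_le_modeFreq_s1 l y

theorem modeFreq_rangeSlice_le (c : List α) {s a : ℕ} (hs : 1 ≤ s) (hsa : s ≤ a) (b : ℕ) :
    modeFreq (rangeSlice c a b) ≤ modeFreq (rangeSlice c s b) := by
  rw [rangeSlice_eq_drop_rangeSlice c hs hsa]
  exact (List.drop_sublist _ _).modeFreq_le

theorem count_rangeSlice_le_add (c : List α) {s a : ℕ} (hs : 1 ≤ s) (hsa : s ≤ a) (b : ℕ) (x : α) :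
    (rangeSlice c s b).count x ≤ (a - s) + (rangeSlice c a b).count x := by
  rw [rangeSlice_eq_drop_rangeSlice c hs hsa]
  conv_lhs => rw [← List.take_append_drop (a - s) (rangeSlice c s b), List.count_append]
  gcongr
  exact List.count_le_length.trans (List.length_take_le _ _)

/-- The element at the first position where the mode frequency of `c[s..r]` reaches a positive
threshold is itself a mode, so it occurs at least that often. -/
theorem le_count_of_first_modeFreq_ge (c : List α) (d : α) {s r : ℕ} {T : ℝ} (hT : 0 < T)
    (hs : 1 ≤ s) (hsr : s ≤ r) (hr : r ≤ c.length)
    (hge : T ≤ modeFreq (rangeSlice c s r))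
    (hlt : ∀ t, s ≤ t → t < r → (modeFreq (rangeSlice c s t) : ℝ) < T) :
    T ≤ (rangeSlice c s r).count (c.getD (r - 1) d) := by
  obtain ⟨t, rfl⟩ : ∃ t, r = t + 1 := ⟨r - 1, by omega⟩
  have hprev : (modeFreq (rangeSlice c s t) : ℝ) < T := by
    rcases hsr.eq_or_lt with rfl | h
    · simpa [rangeSlice, modeFreq] using hT
    · exact hlt t (by omega) (by omega)
  rw [Nat.add_sub_cancel, rangeSlice_succ c hs hsr hr d] at *
  have hmax : (modeFreq (rangeSlice c s t ++ [c.getD t d]) : ℝ) ≤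
      max ((rangeSlice c s t ++ [c.getD t d]).count (c.getD t d) : ℝ)
        (modeFreq (rangeSlice c s t)) := by
    exact_mod_cast modeFreq_concat_le _ _
  exact (le_max_iff.1 (hge.trans hmax)).resolve_right hprev.not_ge

theorem lt_count_rangeSlice_of_first_modeFreq_ge (c : List α) (d : α) {s r a b : ℕ} {T G : ℝ}
    (hT : 0 < T) (hs : 1 ≤ s) (hsr : s ≤ r) (hr : r ≤ c.length)
    (hge : T ≤ modeFreq (rangeSlice c s r))
    (hlt : ∀ t, s ≤ t → t < r → (modeFreq (rangeSlice c s t) : ℝ) < T)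
    (hsa : s ≤ a) (hgap : (a : ℝ) - s < G) (hrb : r ≤ b) :
    T - G < (rangeSlice c a b).count (c.getD (r - 1) d) := by
  have hcount := le_count_of_first_modeFreq_ge c d hT hs hsr hr hge hlt
  have hadd := ((rangeSlice_prefix c hrb).sublist.count_le (c.getD (r - 1) d)).trans
    (count_rangeSlice_le_add c hs hsa b _)
  rify [hsa] at hadd
  linarith

end ModeFreq

/-- The trichotomy at the heart of Lemma 2: with anchors `s, s'` close to `a` and `r, r'`
the first indices at which the mode frequencies of the ranges starting at `s` resp. `s'`
reach `(1+Δ)^{2k}/ε` resp. `(1+Δ)^{2k+1}/ε`, the position of `b` relative to `r, r'`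
determines approximate information about `F(c[a..b])`. -/
theorem stmt1 {α : Type*} [DecidableEq α] [Inhabited α] (ε Δ : ℝ)
    (hε0 : 0 < ε) (hε1 : ε ≤ 1) (hΔ : 0 < Δ) (hΔε : (1 + Δ) ^ 2 = 1 + ε)
    (k : ℕ) (hk : 1 ≤ k) (c : List α) (a b s s' r r' : ℕ)
    (ha : 1 ≤ a) (hab : a ≤ b) (hbn : b ≤ c.length)
    (hs1 : 1 ≤ s) (hsa : s ≤ a)
    (hsgap : (a : ℝ) - s < (Δ / ε) * (1 + Δ) ^ (2 * k - 1))
    (hs'1 : 1 ≤ s') (hs'a : s' ≤ a)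
    (hs'gap : (a : ℝ) - s' < (Δ / ε) * (1 + Δ) ^ (2 * k))
    (hr1 : s ≤ r)
    (hr2 : (modeFreq (rangeSlice c s r) : ℝ) ≥ (1 + Δ) ^ (2 * k) / ε)
    (hr3 : ∀ t, s ≤ t → t < r → (modeFreq (rangeSlice c s t) : ℝ) < (1 + Δ) ^ (2 * k) / ε)
    (hrn : r ≤ c.length)
    (hr'1 : s' ≤ r')
    (hr'2 : (modeFreq (rangeSlice c s' r') : ℝ) ≥ (1 + Δ) ^ (2 * k + 1) / ε)
    (hr'3 : ∀ t, s' ≤ t → t < r' →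
      (modeFreq (rangeSlice c s' t) : ℝ) < (1 + Δ) ^ (2 * k + 1) / ε)
    (hr'n : r' ≤ c.length) :
    (b < r → (modeFreq (rangeSlice c a b) : ℝ) < (1 + Δ) ^ (2 * k) / ε) ∧
    (r' ≤ b →
      ((rangeSlice c a b).count (c.getD (r' - 1) default) : ℝ) > (1 + Δ) ^ (2 * k) / ε) ∧
    (r ≤ b → b < r' →
      ((rangeSlice c a b).count (c.getD (r - 1) default) : ℝ) > (1 + Δ) ^ (2 * k - 1) / ε ∧
      (modeFreq (rangeSlice c a b) : ℝ) < (1 + Δ) ^ (2 * k + 1) / ε) := by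
  have hsub (m : ℕ) :
      (1 + Δ) ^ (m + 1) / ε - Δ / ε * (1 + Δ) ^ m = (1 + Δ) ^ m / ε := by ring
  have hpred : 2 * k - 1 + 1 = 2 * k := by omega
  refine ⟨fun hbr => ?_, fun hrb => ?_, fun hrb hbr => ⟨?_, ?_⟩⟩
  · exact (Nat.cast_le.2 (modeFreq_rangeSlice_le c hs1 hsa b)).trans_lt
      (hr3 b (hsa.trans hab) hbr)
  · have h := lt_count_rangeSlice_of_first_modeFreq_ge c default (by positivity) hs'1 hr'1 hr'n
      hr'2 hr'3 hs'a hs'gap hrb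
    rwa [hsub] at h
  · have h := lt_count_rangeSlice_of_first_modeFreq_ge c default (by positivity) hs1 hr1 hrn
      hr2 hr3 hsa hsgap hrb
    have e := hsub (2 * k - 1)
    rw [hpred] at e
    rwa [e] at h
  · exact (Nat.cast_le.2 (modeFreq_rangeSlice_le c hs'1 hs'a b)).trans_lt
      (hr'3 b (hs'a.trans hab) hbr)
end

section
/- Let c be a list of length n and k ≥ 1 an integer. For each index i with 1 ≤ i ≤ n define Q_k(i) to be the largest index j ∈ [i, n] such that F(c[i..j]) ≤ k (this is well-defined since F(c[i..i]) = 1 ≤ k). Then Q_k is nondecreasing: for all indices i ≤ i' ≤ n, Q_k(i) ≤ Q_k(i'). -/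
theorem modeFreq_le_iff_s3 {α : Type*} [DecidableEq α] {c : List α} {k : ℕ} :
    modeFreq c ≤ k ↔ ∀ x, c.count x ≤ k := by
  have foldr_max_le_iff (l : List ℕ) : l.foldr max 0 ≤ k ↔ ∀ m ∈ l, m ≤ k := by
    induction l with
    | nil => simp
    | cons a l ih => simp [ih]
  rw [modeFreq, foldr_max_le_iff, List.forall_mem_map]
  refine ⟨fun h x => ?_, fun h x _ => h x⟩
  by_cases hx : x ∈ c
  · exact h x hx
  · simp [List.count_eq_zero_of_not_mem hx]

theorem List.Sublist.modeFreq_le_s3 {α : Type*} [DecidableEq α] {c d : List α}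
    (h : c.Sublist d) : modeFreq c ≤ modeFreq d :=
  modeFreq_le_iff_s3.2 fun x => (h.count_le x).trans (modeFreq_le_iff_s3.1 le_rfl x)

theorem rangeSlice_sublist_of_le {α : Type*} (c : List α) {a a' : ℕ} (b : ℕ)
    (ha : 1 ≤ a) (haa' : a ≤ a') : (rangeSlice c a' b).Sublist (rangeSlice c a b) := by
  have h : rangeSlice c a' b = (rangeSlice c a b).drop (a' - a) := by
    have hlen : b + 1 - a - (a' - a) = b + 1 - a' := by omega
    have hstart : a - 1 + (a' - a) = a' - 1 := by omega
    rw [rangeSlice, rangeSlice, List.drop_take, List.drop_drop, hlen, hstart]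
  exact h ▸ List.drop_sublist _ _

/-- `Q_k` is nondecreasing: if `Qi` is the largest index `j ∈ [i, n]` with
`F(c[i..j]) ≤ k` and `Qi'` is the largest index `j ∈ [i', n]` with `F(c[i'..j]) ≤ k`,
where `i ≤ i'`, then `Qi ≤ Qi'`. -/
theorem stmt3 {α : Type*} [DecidableEq α] (c : List α) (k : ℕ) (hk : 1 ≤ k)
    (i i' Qi Qi' : ℕ) (hi : 1 ≤ i) (hii' : i ≤ i') (hi'n : i' ≤ c.length)
    (hQi1 : i ≤ Qi) (hQi2 : Qi ≤ c.length)
    (hQi3 : modeFreq (rangeSlice c i Qi) ≤ k)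
    (hQi4 : ∀ j, Qi < j → j ≤ c.length → k < modeFreq (rangeSlice c i j))
    (hQi'1 : i' ≤ Qi') (hQi'2 : Qi' ≤ c.length)
    (hQi'3 : modeFreq (rangeSlice c i' Qi') ≤ k)
    (hQi'4 : ∀ j, Qi' < j → j ≤ c.length → k < modeFreq (rangeSlice c i' j)) :
    Qi ≤ Qi' := by
  by_contra! h
  exact ((hQi'4 Qi h hQi2).trans_le
    (rangeSlice_sublist_of_le c Qi hi hii').modeFreq_le_s3).not_ge hQi3
end

section
/- Let G, L ≥ 0 be real numbers, m ≥ 1 a natural number, and σ_1 ≤ σ_2 ≤ ... ≤ σ_m and e_1, ..., e_m natural numbers such that for all k: σ_k ≤ e_k ≤ σ_k + L; σ_1 ≤ G; σ_{k+1} − σ_k ≤ G for all k < m; and let f be a natural number with f ≤ e_m + G. Then for all natural numbers p ≤ q with q ≤ f and q − p ≥ G + L, there exists an index k with p ≤ σ_k and e_k ≤ q; that is, the window [p, q] fully contains one of the intervals [σ_k, e_k]. -/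
/-- A family of integer intervals `[σ k, e k]`, `k = 0, …, m-1`, each of length at most `L`,
whose starting points are nondecreasing with consecutive gaps at most `G`, with first start
at most `G` and last endpoint within `G` of `f`, covers every window `[p, q] ⊆ [0, f]`
of length at least `G + L`: some interval `[σ k, e k]` lies fully inside `[p, q]`. -/
theorem stmt7 (G L : ℝ) (hG : 0 ≤ G) (hL : 0 ≤ L) (m : ℕ) (hm : 0 < m)
    (σ e : Fin m → ℕ) (hσmono : Monotone σ)
    (hse : ∀ k, σ k ≤ e k ∧ (e k : ℝ) ≤ (σ k : ℝ) + L)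
    (hfirst : ((σ ⟨0, hm⟩ : ℕ) : ℝ) ≤ G)
    (hgap : ∀ k : Fin m, ∀ h : (k : ℕ) + 1 < m,
      ((σ ⟨(k : ℕ) + 1, h⟩ : ℕ) : ℝ) - (σ k : ℝ) ≤ G)
    (f : ℕ) (hf : (f : ℝ) ≤ (e ⟨m - 1, by omega⟩ : ℝ) + G) :
    ∀ p q : ℕ, p ≤ q → q ≤ f → G + L ≤ (q : ℝ) - (p : ℝ) →
      ∃ k : Fin m, p ≤ σ k ∧ e k ≤ q := by
  intro p q _ hqf hlen
  have hqf' : (q : ℝ) ≤ f := by exact_mod_cast hqf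
  have hp0 : (0 : ℝ) ≤ p := p.cast_nonneg
  by_contra! hcon
  have hlt : ∀ n : ℕ, ∀ hn : n < m, σ ⟨n, hn⟩ < p := by
    intro n
    induction n with
    | zero =>
      intro hn
      by_contra! hp
      have h₁ : (q : ℝ) < e ⟨0, hn⟩ := by exact_mod_cast hcon _ hp
      linarith [(hse ⟨0, hn⟩).2]
    | succ n ih =>
      intro hn
      by_contra! hp
      have h₁ : (q : ℝ) < e ⟨n + 1, hn⟩ := by exact_mod_cast hcon _ hp
      have h₂ : (σ ⟨n, by omega⟩ : ℝ) < p := by exact_mod_cast ih (by omega)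
      linarith [(hse ⟨n + 1, hn⟩).2, hgap ⟨n, by omega⟩ hn]
  have hlast : (σ ⟨m - 1, by omega⟩ : ℝ) < p := by exact_mod_cast hlt (m - 1) (by omega)
  linarith [(hse ⟨m - 1, by omega⟩).2]
end

section
/- Let A and B be multisets over a linear order with A ≤ B (A is a sub-multiset of B), and let d := |B| − |A|. Suppose z and the positive integer k are such that z realizes rank k in A. Then there exists an integer k' with k ≤ k' ≤ k + d such that z realizes rank k' in B. -/
/-- `z` realizes rank `k` in the multiset `M`: fewer than `k` elements of `M` are
strictly less than `z`, and at least `k` elements of `M` are at most `z`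
(so `z` can serve as the `k`-th smallest element of `M`). -/
def realizesRank {α : Type*} [LinearOrder α] (z : α) (k : ℕ) (M : Multiset α) : Prop :=
  (M.filter (fun y => y < z)).card < k ∧ k ≤ (M.filter (fun y => y ≤ z)).card

/-- If `A ≤ B` are multisets with `d = |B| - |A|` and `z` realizes rank `k ≥ 1` in `A`,
then `z` realizes some rank `k'` with `k ≤ k' ≤ k + d` in `B`. -/
theorem stmt9 {α : Type*} [LinearOrder α] (A B : Multiset α) (hAB : A ≤ B)
    (z : α) (k : ℕ) (hk : 1 ≤ k) (h : realizesRank z k A) :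
    ∃ k', k ≤ k' ∧ k' ≤ k + (Multiset.card B - Multiset.card A) ∧ realizesRank z k' B := by
  obtain ⟨C, rfl⟩ := Multiset.le_iff_exists_add.mp hAB
  obtain ⟨hlt, hle⟩ := h
  have hC : (C.filter (fun y => y < z)).card ≤ (C.filter (fun y => y ≤ z)).card :=
    Multiset.card_le_card (Multiset.monotone_filter_right C fun _ hy => le_of_lt hy)
  have hCcard : (C.filter (fun y => y < z)).card ≤ C.card :=
    Multiset.card_le_card (Multiset.filter_le _ C)
  refine ⟨k + (C.filter (fun y => y < z)).card, by omega, ?_, ?_, ?_⟩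
  · rw [Multiset.card_add]
    omega
  · rw [Multiset.filter_add, Multiset.card_add]
    omega
  · rw [Multiset.filter_add, Multiset.card_add]
    omega
end

section
/- Let c be a list of length n over a linear order, let 1 ≤ a ≤ r ≤ s ≤ b ≤ n be indices, and set D := (r − a) + (b − s). Let f : ℕ → ℕ satisfy 1 ≤ f(x) ≤ x and f(x) ≤ f(x+1) ≤ f(x) + 1 for all x ≥ 1. Suppose z is an element realizing rank f(s − r + 1) in c[r..s]. Then there exists an integer k' with |k' − f(b − a + 1)| ≤ D such that z realizes rank k' in c[a..b]. In particular, if D ≤ α·(b − a + 1), then z is an α-approximate answer to the rank-f query on the range c[a..b]. -/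
/-- `z` realizes rank `k` in the list `L`: fewer than `k` elements of `L` are strictly
less than `z`, and at least `k` elements of `L` are at most `z`. -/
def realizesRankL {α : Type*} [LinearOrder α] (z : α) (k : ℕ) (L : List α) : Prop :=
  L.countP (fun y => decide (y < z)) < k ∧ k ≤ L.countP (fun y => decide (y ≤ z))

/-- A range slice splits as a prefix, any nested range slice, and a suffix. -/
theorem rangeSlice_eq_append {α : Type*} (c : List α) {a r s b : ℕ}
    (ha : 1 ≤ a) (har : a ≤ r) (hrs : r ≤ s) (hsb : s ≤ b) :
    ∃ X Y : List α, rangeSlice c a b = X ++ (rangeSlice c r s ++ Y) ∧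
      X.length ≤ r - a ∧ Y.length ≤ b - s := by
  refine ⟨(c.drop (a - 1)).take (r - a), (c.drop s).take (b - s), ?_, by simp, by simp⟩
  have h₁ : b + 1 - a = (r - a) + ((s + 1 - r) + (b - s)) := by omega
  have h₂ : a - 1 + (r - a) = r - 1 := by omega
  have h₃ : r - 1 + (s + 1 - r) = s := by omega
  simp only [rangeSlice]
  rw [h₁, List.take_add, List.take_add, List.drop_drop, List.drop_drop, h₂, h₃]

/-- A function with increments in `{0, 1}` at positive arguments grows by at most `d`
over `d` steps. -/
theorem le_apply_add_and_apply_add_le {f : ℕ → ℕ}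
    (hf : ∀ x, 1 ≤ x → f x ≤ f (x + 1) ∧ f (x + 1) ≤ f x + 1) {x : ℕ} (hx : 1 ≤ x) (d : ℕ) :
    f x ≤ f (x + d) ∧ f (x + d) ≤ f x + d := by
  induction d with
  | zero => simp
  | succ d ih =>
    have := hf (x + d) (by omega)
    rw [← add_assoc]
    omega

/-- If `z` realizes rank `f(s - r + 1)` in the inner range `c[r..s]` of `c[a..b]`, where
`f` is a monotone rank function with `1 ≤ f(x) ≤ x` and `f(x) ≤ f(x+1) ≤ f(x) + 1`,
then `z` realizes some rank `k'` in `c[a..b]` with `|k' - f(b - a + 1)| ≤ D`, where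
`D = (r - a) + (b - s)`. -/
theorem stmt10 {α : Type*} [LinearOrder α] (c : List α) (a r s b : ℕ)
    (ha : 1 ≤ a) (har : a ≤ r) (hrs : r ≤ s) (hsb : s ≤ b) (hbn : b ≤ c.length)
    (f : ℕ → ℕ)
    (hf : ∀ x, 1 ≤ x → 1 ≤ f x ∧ f x ≤ x ∧ f x ≤ f (x + 1) ∧ f (x + 1) ≤ f x + 1)
    (z : α) (hz : realizesRankL z (f (s - r + 1)) (rangeSlice c r s)) :
    ∃ k' : ℕ, |(k' : ℤ) - (f (b - a + 1) : ℤ)| ≤ (((r - a) + (b - s) : ℕ) : ℤ) ∧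
      realizesRankL z k' (rangeSlice c a b) := by
  obtain ⟨X, Y, hXY, hX, hY⟩ := rangeSlice_eq_append c ha har hrs hsb
  have hgrow := le_apply_add_and_apply_add_le (fun x hx => (hf x hx).2.2)
    (Nat.le_add_left 1 (s - r)) ((r - a) + (b - s))
  rw [show s - r + 1 + ((r - a) + (b - s)) = b - a + 1 by omega] at hgrow
  have hlt_le (L : List α) :
      L.countP (fun y => decide (y < z)) ≤ L.countP (fun y => decide (y ≤ z)) :=
    List.countP_mono_left fun y _ h => by simpa using (of_decide_eq_true h).le
  have hX' := hlt_le X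
  have hY' := hlt_le Y
  have hXl : X.countP (fun y => decide (y < z)) ≤ X.length := List.countP_le_length
  have hYl : Y.countP (fun y => decide (y < z)) ≤ Y.length := List.countP_le_length
  obtain ⟨hz₁, hz₂⟩ := hz
  refine ⟨f (s - r + 1) + (X.countP (fun y => decide (y < z)) +
    Y.countP (fun y => decide (y < z))), ?_, ?_⟩
  · rw [abs_le]
    omega
  · simp only [realizesRankL, hXY, List.countP_append]
    omega
end

section
/- Let ε > 0, let k := ⌈1+ε⌉ + 1, and let t_1, t_2, ..., t_{k+1} be pairwise distinct elements. Let A be the list consisting of t_1 repeated k times followed by t_2, ..., t_{k+1} (one occurrence each). If x is a (1+ε)-approximate mode of A, i.e., x occurs in A and (1+ε)·count(x, A) ≥ F(A), then x = t_1. -/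
theorem List.le_foldr_max {l : List ℕ} {a : ℕ} (h : a ∈ l) : a ≤ l.foldr max 0 := by
  induction l with
  | nil => simp at h
  | cons b l ih =>
    rcases List.mem_cons.1 h with rfl | h
    · exact le_max_left _ _
    · exact (ih h).trans (le_max_right _ _)

/-- Let `k = ⌈1+ε⌉ + 1` and let `A` consist of `t 0` repeated `k` times followed by the
`k` distinct elements `t 1, …, t k` (one occurrence each). Then any `(1+ε)`-approximate
mode of `A` must equal `t 0`. -/
theorem stmt13 {α : Type*} [DecidableEq α] (ε : ℝ) (hε : 0 < ε) (k : ℕ)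
    (hk : k = ⌈1 + ε⌉₊ + 1) (t : Fin (k + 1) → α) (ht : Function.Injective t)
    (A : List α)
    (hA : A = List.replicate k (t 0) ++ List.ofFn (fun i : Fin k => t i.succ))
    (x : α) (hxA : x ∈ A)
    (happrox : (1 + ε) * (A.count x : ℝ) ≥ (modeFreq A : ℝ)) :
    x = t 0 := by
  by_contra hx
  have hmode : k ≤ modeFreq A := by
    refine le_trans ?_ (count_le_modeFreq A (t 0))
    rw [hA, List.count_append, List.count_replicate_self]
    exact Nat.le_add_right _ _
  have hcount : A.count x ≤ 1 := by
    have hnodup : (List.ofFn fun i : Fin k => t i.succ).Nodup :=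
      List.nodup_ofFn.2 (ht.comp (Fin.succ_injective k))
    rw [hA, List.count_append,
      List.count_eq_zero_of_not_mem fun h => hx (List.eq_of_mem_replicate h), zero_add]
    exact List.nodup_iff_count_le_one.1 hnodup x
  have hcount' : (A.count x : ℝ) ≤ 1 := by exact_mod_cast hcount
  have hmode' : (k : ℝ) ≤ modeFreq A := by exact_mod_cast hmode
  have hk' : (k : ℝ) = ⌈1 + ε⌉₊ + 1 := by exact_mod_cast hk
  have hceil := Nat.le_ceil (1 + ε)
  nlinarith
end
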